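/- Let σ: ℝ → ℝ be the bump function σ(x) = exp(−1/(1−x²)) for |x| < 1 and σ(x) = 0 otherwise. Then there is an absolute constant C such that for all positive integers N, the L¹-norm of the N-th derivative satisfies ‖σ^{(N)}‖₁ ≤ C·(2N)^{2N}. -/

import Mathlib

open MeasureTheory

/-- The standard bump function `σ(x) = exp(−1/(1−x²))` on `(−1,1)`, extended by zero. -/
noncomputable def sigmaBump : ℝ → ℝ := fun x => if |x| < 1 then Real.exp (-1 / (1 - x ^ 2)) else 0

open Set Filter Topology

/-- The holomorphic extension of the bump function off the points `±1`. -/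
noncomputable def complexBump (z : ℂ) : ℂ := Complex.exp (-1 / (1 - z ^ 2))

lemma differentiableOn_complexBump : DifferentiableOn ℂ complexBump {z : ℂ | 1 - z ^ 2 ≠ 0} := by
  intro z hz
  apply DifferentiableAt.differentiableWithinAt
  unfold complexBump
  have h : DifferentiableAt ℂ (fun z : ℂ => -1 / (1 - z ^ 2)) z :=
    (differentiableAt_const _).div (by fun_prop) hz
  exact h.cexp

lemma isOpen_one_sub_sq_ne_zero : IsOpen {z : ℂ | 1 - z ^ 2 ≠ 0} :=
  isOpen_ne_fun (by fun_prop) continuous_const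

lemma re_complexBump_ofReal {x : ℝ} (hx : |x| < 1) : (complexBump x).re = sigmaBump x := by
  have h : complexBump x = ((Real.exp (-1 / (1 - x ^ 2)) : ℝ) : ℂ) := by
    simp [complexBump]
  rw [h, Complex.ofReal_re, sigmaBump, if_pos hx]

lemma one_sub_ofReal_sq_ne_zero {x : ℝ} (hx : |x| < 1) : 1 - (x : ℂ) ^ 2 ≠ 0 := by
  have h : 1 - x ^ 2 ≠ 0 := by nlinarith [(sq_lt_one_iff_abs_lt_one x).2 hx]
  exact_mod_cast h

lemma iteratedDeriv_sigmaBump_eq_re (n : ℕ) {x : ℝ} (hx : |x| < 1) :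
    iteratedDeriv n sigmaBump x = (iteratedDeriv n complexBump x).re := by
  induction n generalizing x with
  | zero => simp [re_complexBump_ofReal hx]
  | succ n ih =>
    have han := (differentiableOn_complexBump.analyticOnNhd isOpen_one_sub_sq_ne_zero).iterated_deriv n
    have hd := (han x (one_sub_ofReal_sq_ne_zero hx)).differentiableAt.hasDerivAt.real_of_complex
    have heq : iteratedDeriv n sigmaBump =ᶠ[𝓝 x]
        fun y : ℝ => (deriv^[n] complexBump y).re := by
      filter_upwards [(continuous_abs.isOpen_preimage _ isOpen_Iio).mem_nhds hx] with y hy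
      rw [ih hy, iteratedDeriv_eq_iterate]
    rw [iteratedDeriv_succ, (hd.congr_of_eventuallyEq heq).deriv, iteratedDeriv_succ,
      iteratedDeriv_eq_iterate]

lemma iteratedDeriv_sigmaBump_eq_zero (n : ℕ) {x : ℝ} (hx : 1 < |x|) :
    iteratedDeriv n sigmaBump x = 0 := by
  have heq : sigmaBump =ᶠ[𝓝 x] fun _ => 0 := by
    filter_upwards [(continuous_abs.isOpen_preimage _ isOpen_Ioi).mem_nhds hx] with y hy
    exact if_neg (not_lt.2 (mem_Ioi.1 hy).le)
  rw [heq.iteratedDeriv_eq]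
  simp

lemma normSq_le_of_norm_sub_ofReal_le {w : ℂ} {s : ℝ} (h : ‖w - s‖ ≤ s / 2) :
    2 * Complex.normSq w ≤ 3 * s * w.re := by
  have h1 : w.re - s ≤ s / 2 := by simpa using (Complex.re_le_norm (w - s)).trans h
  have h2 : Complex.normSq (w - s) ≤ (s / 2) ^ 2 := by
    rw [Complex.normSq_eq_norm_sq]; gcongr
  simp only [Complex.normSq_apply, Complex.sub_re, Complex.sub_im, Complex.ofReal_re,
    Complex.ofReal_im] at h2 ⊢
  have hs : 0 ≤ s := by linarith [(norm_nonneg _).trans h]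
  nlinarith [mul_nonneg hs (sub_nonneg.2 h1)]

lemma ne_zero_of_norm_sub_ofReal_le {w : ℂ} {s : ℝ} (hs : 0 < s) (h : ‖w - s‖ ≤ s / 2) :
    w ≠ 0 := by
  rintro rfl
  simp [abs_of_pos hs] at h
  linarith

lemma inv_le_re_inv_of_norm_sub_ofReal_le {w : ℂ} {s : ℝ} (hs : 0 < s) (h : ‖w - s‖ ≤ s / 2) :
    2 / 3 * s⁻¹ ≤ (w⁻¹).re := by
  have hw := Complex.normSq_pos.2 (ne_zero_of_norm_sub_ofReal_le hs h)
  have := normSq_le_of_norm_sub_ofReal_le h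
  rw [Complex.inv_re, ← div_eq_mul_inv, div_div, div_le_div_iff₀ (by positivity) hw]
  linarith

section Disc

variable {x : ℝ} {z : ℂ}

lemma norm_one_sub_sub_le (hz : ‖z - x‖ ≤ (1 - |x|) / 2) :
    ‖(1 - z) - ((1 - x : ℝ) : ℂ)‖ ≤ (1 - x) / 2 := by
  rw [show (1 - z) - ((1 - x : ℝ) : ℂ) = -(z - x) by push_cast; ring, norm_neg]
  linarith [le_abs_self x]

lemma norm_one_add_sub_le (hz : ‖z - x‖ ≤ (1 - |x|) / 2) :
    ‖(1 + z) - ((1 + x : ℝ) : ℂ)‖ ≤ (1 + x) / 2 := by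
  rw [show (1 + z) - ((1 + x : ℝ) : ℂ) = z - x by push_cast; ring]
  linarith [neg_abs_le x]

lemma one_sub_sq_ne_zero_of_norm_sub_le (hx : |x| < 1) (hz : ‖z - x‖ ≤ (1 - |x|) / 2) :
    1 - z ^ 2 ≠ 0 := by
  obtain ⟨h1, h2⟩ := abs_lt.1 hx
  rw [show 1 - z ^ 2 = (1 - z) * (1 + z) by ring]
  exact mul_ne_zero (ne_zero_of_norm_sub_ofReal_le (by linarith) (norm_one_sub_sub_le hz))
    (ne_zero_of_norm_sub_ofReal_le (by linarith) (norm_one_add_sub_le hz))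

lemma norm_complexBump_le (hx : |x| < 1) (hz : ‖z - x‖ ≤ (1 - |x|) / 2) :
    ‖complexBump z‖ ≤ Real.exp (-(3 * (1 - |x|))⁻¹) := by
  obtain ⟨h1, h2⟩ := abs_lt.1 hx
  have hp : 0 < 1 - x := by linarith
  have hq : 0 < 1 + x := by linarith
  have e1 := inv_le_re_inv_of_norm_sub_ofReal_le hp (norm_one_sub_sub_le hz)
  have e2 := inv_le_re_inv_of_norm_sub_ofReal_le hq (norm_one_add_sub_le hz)
  have hsplit : -1 / (1 - z ^ 2) = -(((1 / 2 : ℝ) : ℂ) * ((1 - z)⁻¹ + (1 + z)⁻¹)) := by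
    have n1 := ne_zero_of_norm_sub_ofReal_le hp (norm_one_sub_sub_le hz)
    have n2 := ne_zero_of_norm_sub_ofReal_le hq (norm_one_add_sub_le hz)
    rw [show 1 - z ^ 2 = (1 - z) * (1 + z) by ring]
    push_cast
    field_simp
    ring
  have hmax : (1 - |x|)⁻¹ ≤ (1 - x)⁻¹ + (1 + x)⁻¹ := by
    have := inv_pos.2 hp
    have := inv_pos.2 hq
    rcases abs_cases x with ⟨h, -⟩ | ⟨h, -⟩ <;> rw [h]
    · linarith
    · rw [sub_neg_eq_add]; linarith
  rw [complexBump, Complex.norm_exp, hsplit, Complex.neg_re, Complex.re_ofReal_mul, Complex.add_re,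
    mul_inv]
  refine Real.exp_le_exp.2 ?_
  linarith

end Disc

lemma abs_iteratedDeriv_sigmaBump_le (n : ℕ) {x : ℝ} (hx : |x| < 1) :
    |iteratedDeriv n sigmaBump x| ≤ (n.factorial : ℝ) ^ 2 * 6 ^ n := by
  have ht : 0 < 1 - |x| := by linarith
  have hcauchy := Complex.norm_iteratedDeriv_le_of_forall_mem_sphere_norm_le n (half_pos ht)
    (f := complexBump) (c := x) (C := Real.exp (-(3 * (1 - |x|))⁻¹))
    (DifferentiableOn.diffContOnCl_ball (fun z hz => (differentiableOn_complexBump.mono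
      (fun z hz => one_sub_sq_ne_zero_of_norm_sub_le hx (mem_closedBall_iff_norm.1 hz))) z hz)
      subset_rfl)
    (fun z hz => norm_complexBump_le hx (mem_sphere_iff_norm.1 hz).le)
  have hexp := Real.pow_div_factorial_le_exp (3 * (1 - |x|))⁻¹ (by positivity) n
  rw [iteratedDeriv_sigmaBump_eq_re n hx]
  refine (Complex.abs_re_le_norm _).trans (hcauchy.trans ?_)
  rw [div_le_iff₀ (by positivity), Real.exp_neg, ← div_eq_mul_inv, div_le_iff₀ (Real.exp_pos _)]
  calc (n.factorial : ℝ)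
      = (n.factorial : ℝ) ^ 2 * 6 ^ n * ((1 - |x|) / 2) ^ n *
        ((3 * (1 - |x|))⁻¹ ^ n / n.factorial) := by
        have : (6 : ℝ) ^ n * ((1 - |x|) / 2) ^ n * (3 * (1 - |x|))⁻¹ ^ n = 1 := by
          rw [← mul_pow, ← mul_pow]
          convert one_pow n using 2
          field_simp
          norm_num
        have hf : (n.factorial : ℝ) ≠ 0 := by positivity
        field_simp at this ⊢
        linear_combination (-1 : ℝ) * this
    _ ≤ _ := by gcongr

lemma two_mul_pow_self_le_succ_pow {n : ℕ} (hn : n ≠ 0) : 2 * n ^ n ≤ (n + 1) ^ n := by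
  obtain ⟨m, rfl⟩ := Nat.exists_eq_succ_of_ne_zero hn
  have h := one_add_mul_le_pow (a := ((m + 1 : ℕ) : ℝ)⁻¹)
    (by linarith [inv_nonneg.2 (Nat.cast_nonneg (α := ℝ) (m + 1))]) (m + 1)
  have hm : ((m + 1 : ℕ) : ℝ) ≠ 0 := by positivity
  rw [mul_inv_cancel₀ hm] at h
  have key : (2 : ℝ) * ((m + 1 : ℕ) : ℝ) ^ (m + 1) ≤ (((m + 1 : ℕ) : ℝ) + 1) ^ (m + 1) := by
    calc (2 : ℝ) * ((m + 1 : ℕ) : ℝ) ^ (m + 1)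
        ≤ (1 + ((m + 1 : ℕ) : ℝ)⁻¹) ^ (m + 1) * ((m + 1 : ℕ) : ℝ) ^ (m + 1) := by
          gcongr
          linarith
      _ = _ := by rw [← mul_pow, add_mul, inv_mul_cancel₀ hm, one_mul]
  exact_mod_cast key

lemma two_pow_mul_factorial_le (n : ℕ) : 2 ^ n * n.factorial ≤ 2 * n ^ n := by
  induction n with
  | zero => simp
  | succ n ih =>
    rcases eq_or_ne n 0 with rfl | hn
    · simp
    calc 2 ^ (n + 1) * (n + 1).factorial = 2 * (n + 1) * (2 ^ n * n.factorial) := by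
          rw [Nat.factorial_succ]; ring
      _ ≤ 2 * (n + 1) * (2 * n ^ n) := by gcongr
      _ ≤ 2 * (n + 1) * (n + 1) ^ n := by gcongr; exact two_mul_pow_self_le_succ_pow hn
      _ = _ := by ring

/-- There is an absolute constant `C` such that `‖σ^{(N)}‖₁ ≤ C·(2N)^{2N}` for all `N ≥ 1`. -/
theorem bump_iteratedDeriv_L1_bound :
    ∃ C : ℝ, 0 < C ∧ ∀ N : ℕ, 1 ≤ N →
      (∫ x : ℝ, |iteratedDeriv N sigmaBump x|) ≤ C * ((2 * N : ℝ)) ^ (2 * N) := by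
  refine ⟨8, by norm_num, fun N _ => ?_⟩
  set M : ℝ := (N.factorial : ℝ) ^ 2 * 6 ^ N
  have hbound : (∫ x : ℝ, |iteratedDeriv N sigmaBump x|) ≤
      ∫ x : ℝ, (Icc (-1 : ℝ) 1).indicator (fun _ => M) x := by
    refine integral_mono_of_nonneg (.of_forall fun _ => abs_nonneg _)
      ((integrable_indicator_iff measurableSet_Icc).2 (by simp)) ?_
    have hnull : ({1, -1} : Set ℝ)ᶜ ∈ ae volume :=
      compl_mem_ae_iff.2 ((toFinite ({1, -1} : Set ℝ)).measure_zero volume)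
    filter_upwards [hnull] with x hx
    rcases lt_trichotomy |x| 1 with h | h | h
    · rw [indicator_of_mem (mem_Icc.2 (abs_le.1 h.le))]
      exact abs_iteratedDeriv_sigmaBump_le N h
    · exact (hx (eq_or_eq_neg_of_abs_eq h)).elim
    · rw [iteratedDeriv_sigmaBump_eq_zero N h, abs_zero]
      exact indicator_nonneg (fun _ _ => by positivity) x
  rw [integral_indicator measurableSet_Icc, setIntegral_const] at hbound
  have hfact : (2 : ℝ) ^ N * N.factorial ≤ 2 * (N : ℝ) ^ N := by
    exact_mod_cast two_pow_mul_factorial_le N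
  have hvol : volume.real (Icc (-1 : ℝ) 1) = 2 := by
    rw [Real.volume_real_Icc]; norm_num
  rw [hvol, smul_eq_mul] at hbound
  calc _ ≤ 2 * M := hbound
    _ ≤ 2 * ((N.factorial : ℝ) ^ 2 * 16 ^ N) := by
        simp only [M]; gcongr; norm_num
    _ = 2 * (2 ^ N * (2 ^ N * N.factorial)) ^ 2 := by
        rw [mul_pow, mul_pow, ← pow_mul, show (16 : ℝ) = 2 ^ 4 by norm_num, ← pow_mul]; ring
    _ ≤ 2 * (2 ^ N * (2 * (N : ℝ) ^ N)) ^ 2 := by gcongr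
    _ = _ := by rw [mul_comm 2 N, pow_mul]; ring
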